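/- arXiv:1507.04330 — 2 statements merged into one kernel-verified Lean document; each statement's English description precedes it below -/
import Mathlib

section
/- For any of the four topology changes and any linear order π, every vertex v present in both G_old and G_new whose greedy-MIS membership differs between the two graphs (i.e., v belongs to exactly one of M(G_old,π) and M(G_new,π), where π is restricted/induced appropriately on each vertex set) belongs to the influenced set S(G_old,G_new,π). -/
open scoped Classical

noncomputable section

variable {V : Type*}

/-- The MIS invariant: `v ∈ M` iff no earlier neighbor of `v` is in `M`. -/
def misInv (G : SimpleGraph V) (π : V → ℕ) (M : Set V) : Prop :=
  ∀ v, v ∈ M ↔ ∀ u, G.Adj u v → π u < π v → u ∉ M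

/-- Membership in the greedy MIS of `G` under the order `π`. -/
def greedy (G : SimpleGraph V) (π : V → ℕ) (v : V) : Prop :=
  ∀ u, G.Adj u v → ∀ _hlt : π u < π v, ¬ greedy G π u
termination_by π v

/-- The greedy MIS of `G` under the order `π`. -/
def greedySet (G : SimpleGraph V) (π : V → ℕ) : Set V := {v | greedy G π v}

/-- The MIS invariant holds at vertex `v` for states `M`. -/
def invAt (G : SimpleGraph V) (M : Set V) (π : V → ℕ) (v : V) : Prop :=
  v ∈ M ↔ ∀ u, G.Adj u v → π u < π v → u ∉ M

/-- `I_π(u)`: neighbors of `u` preceding `u` in `π`. -/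
def Iset (G : SimpleGraph V) (π : V → ℕ) (u : V) : Set V :=
  {w | G.Adj w u ∧ π w < π u}

/-- The layers `S_i` of the influenced set. -/
def Slayer (H : SimpleGraph V) (M : Set V) (π : V → ℕ) (v0 : V) : ℕ → Set V
  | 0 => {v0}
  | i + 1 =>
      {u | u ∈ M ∧ ∃ w ∈ Slayer H M π v0 i, w ∈ Iset H π u} ∪
      {u | u ∉ M ∧ ∀ w ∈ Iset H π u, w ∈ M → ∃ j, ∃ _hj : j ≤ i, w ∈ Slayer H M π v0 j}
decreasing_by all_goals omega

/-- The union of all layers. -/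
def Sunion (H : SimpleGraph V) (M : Set V) (π : V → ℕ) (v0 : V) : Set V :=
  ⋃ i, Slayer H M π v0 i

/-- The influenced set: empty when the invariant is not `broken` at `v0`. -/
def Sinfl (H : SimpleGraph V) (M : Set V) (π : V → ℕ) (v0 : V) (broken : Prop) : Set V :=
  if broken then Sunion H M π v0 else ∅

/-- The order obtained from `π` by moving `v0` to be first. -/
def pushFirst (π : V → ℕ) (v0 : V) : V → ℕ :=
  fun v => if v = v0 then 0 else π v + 1

/-- The ℕ-valued order attached to a uniformly random bijection `V ≃ Fin |V|`. -/
def toOrd [Fintype V] (π : V ≃ Fin (Fintype.card V)) : V → ℕ := fun v => (π v : ℕ)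

/-- `π` and `σ` induce the same relative order on `A`. -/
def sameOrderOn (π σ : V → ℕ) (A : Set V) : Prop :=
  ∀ x ∈ A, ∀ y ∈ A, (π x < π y ↔ σ x < σ y)

/-- Data describing a topology change: the old and new graphs, the graph `HS` in which
the influenced set `S` is computed, the graph `HSp` in which `S'` is computed,
the distinguished vertices `vs = v*` and `vss = v**`, the states `M` (as a function of
the order), and the condition `broken` under which the invariant fails at `v*`. -/
structure ChangeData (V : Type*) where
  Gold : SimpleGraph V
  Gnew : SimpleGraph V
  HS : SimpleGraph V
  HSp : SimpleGraph V
  vs : V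
  vss : V
  M : (V → ℕ) → Set V
  broken : (V → ℕ) → Prop

variable {V : Type*}

/-- Edge insertion between `v*` and `v**`. -/
def IsEdgeIns (c : ChangeData V) : Prop :=
  c.vs ≠ c.vss ∧ ¬ c.Gold.Adj c.vs c.vss ∧
  (∀ x y, c.Gnew.Adj x y ↔ c.Gold.Adj x y ∨ (x = c.vs ∧ y = c.vss) ∨ (x = c.vss ∧ y = c.vs)) ∧
  c.HS = c.Gnew ∧ c.HSp = c.Gold ∧
  (∀ π, c.M π = greedySet c.Gold π) ∧
  (∀ π, c.broken π ↔ ¬ invAt c.Gnew (c.M π) π c.vs)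

/-- Edge deletion between `v*` and `v**`. -/
def IsEdgeDel (c : ChangeData V) : Prop :=
  c.vs ≠ c.vss ∧ c.Gold.Adj c.vs c.vss ∧
  (∀ x y, c.Gnew.Adj x y ↔ c.Gold.Adj x y ∧ ¬ ((x = c.vs ∧ y = c.vss) ∨ (x = c.vss ∧ y = c.vs))) ∧
  c.HS = c.Gnew ∧ c.HSp = c.Gnew ∧
  (∀ π, c.M π = greedySet c.Gold π) ∧
  (∀ π, c.broken π ↔ ¬ invAt c.Gnew (c.M π) π c.vs)

/-- Deletion of the node `v*` (modeled on a common vertex type: `v*` is isolated in `Gnew`). -/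
def IsNodeDel (c : ChangeData V) : Prop :=
  c.vss = c.vs ∧
  (∀ x y, c.Gnew.Adj x y ↔ c.Gold.Adj x y ∧ x ≠ c.vs ∧ y ≠ c.vs) ∧
  c.HS = c.Gold ∧ c.HSp = c.Gold ∧
  (∀ π, c.M π = greedySet c.Gold π) ∧
  (∀ π, c.broken π ↔ c.vs ∈ c.M π)

/-- Insertion of the node `v*` (modeled on a common vertex type: `v*` is isolated in `Gold`). -/
def IsNodeIns (c : ChangeData V) : Prop :=
  c.vss = c.vs ∧
  (∀ x y, c.Gold.Adj x y ↔ c.Gnew.Adj x y ∧ x ≠ c.vs ∧ y ≠ c.vs) ∧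
  c.HS = c.Gnew ∧ c.HSp = c.Gnew ∧
  (∀ π, c.M π = greedySet c.Gold π \ {c.vs}) ∧
  (∀ π, c.broken π ↔ ¬ ∃ u, c.Gnew.Adj u c.vs ∧ π u < π c.vs ∧ u ∈ c.M π)

/-- One of the four topology changes. -/
def IsTopoChange (c : ChangeData V) : Prop :=
  IsEdgeIns c ∨ IsEdgeDel c ∨ IsNodeDel c ∨ IsNodeIns c

/-- The influenced set `S(G_old, G_new, π)`. -/
def Sset (c : ChangeData V) (π : V → ℕ) : Set V :=
  Sinfl c.HS (c.M π) π c.vs (c.broken π)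

/-- The set `S'(G_old, G_new, τ, v*)`: same recursion, from `v*` always, in the graph `HSp`,
with `v*` moved to be first in the order, and states given by `M(G_old, τ)`. -/
def Spset (c : ChangeData V) (τ : V → ℕ) : Set V :=
  ⋃ i, Slayer c.HSp (c.M τ) (pushFirst τ c.vs) c.vs i


theorem mem_greedySet_iff (G : SimpleGraph V) (π : V → ℕ) (v : V) :
    v ∈ greedySet G π ↔ ∀ u, G.Adj u v → π u < π v → u ∉ greedySet G π := by
  change greedy G π v ↔ ∀ u, G.Adj u v → π u < π v → ¬ greedy G π u
  rw [greedy]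

theorem self_mem_Sunion (H : SimpleGraph V) (M : Set V) (π : V → ℕ) (v0 : V) :
    v0 ∈ Sunion H M π v0 :=
  Set.mem_iUnion.2 ⟨0, by simp [Slayer]⟩

theorem mem_Sunion_of_mem {H : SimpleGraph V} {M : Set V} {π : V → ℕ} {v0 u w : V}
    (hu : u ∈ M) (hw : w ∈ Sunion H M π v0) (hwu : w ∈ Iset H π u) :
    u ∈ Sunion H M π v0 := by
  obtain ⟨i, hi⟩ := Set.mem_iUnion.1 hw
  refine Set.mem_iUnion.2 ⟨i + 1, ?_⟩
  rw [Slayer]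
  exact Or.inl ⟨hu, w, hi, hwu⟩

theorem mem_Sunion_of_notMem [Finite V] {H : SimpleGraph V} {M : Set V} {π : V → ℕ} {v0 u : V}
    (hu : u ∉ M) (h : ∀ w ∈ Iset H π u, w ∈ M → w ∈ Sunion H M π v0) :
    u ∈ Sunion H M π v0 := by
  have hidx : ∀ w, ∃ i, w ∈ Sunion H M π v0 → w ∈ Slayer H M π v0 i := by
    intro w
    by_cases hw : w ∈ Sunion H M π v0
    · obtain ⟨i, hi⟩ := Set.mem_iUnion.1 hw
      exact ⟨i, fun _ => hi⟩
    · exact ⟨0, fun h' => absurd h' hw⟩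
  choose f hf using hidx
  obtain ⟨n, hn⟩ := (Set.finite_range f).bddAbove
  refine Set.mem_iUnion.2 ⟨n + 1, ?_⟩
  rw [Slayer]
  exact Or.inr ⟨hu, fun w hw hwM => ⟨f w, hn ⟨w, rfl⟩, hf w (h w hw hwM)⟩⟩

/-- Two sets of states satisfying the invariant away from `v0` differ only on the union of the
layers started at `v0`. -/
theorem mem_Sunion_of_not_iff [Finite V] {H : SimpleGraph V} {M N : Set V} {π : V → ℕ} {v0 : V}
    (hM : ∀ v ≠ v0, invAt H M π v) (hN : ∀ v ≠ v0, invAt H N π v)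
    (v : V) (hv : ¬ (v ∈ M ↔ v ∈ N)) : v ∈ Sunion H M π v0 := by
  induction hk : π v using Nat.strong_induction_on generalizing v with
  | _ k ih =>
    subst hk
    by_cases hv0 : v = v0
    · exact hv0 ▸ self_mem_Sunion H M π v0
    have hMv := hM v hv0
    have hNv := hN v hv0
    unfold invAt at hMv hNv
    by_cases hvM : v ∈ M
    · have hvN : v ∉ N := fun h => hv (iff_of_true hvM h)
      rw [hNv] at hvN
      push Not at hvN
      obtain ⟨u, hadj, hlt, huN⟩ := hvN
      have huM := hMv.1 hvM u hadj hlt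
      exact mem_Sunion_of_mem hvM (ih _ hlt u (fun h => huM (h.2 huN)) rfl) ⟨hadj, hlt⟩
    · have hvN : v ∈ N := by tauto
      refine mem_Sunion_of_notMem hvM fun w hw hwM => ?_
      exact ih _ hw.2 w (fun h => hNv.1 hvN w hw.1 hw.2 (h.1 hwM)) rfl

theorem iff_of_invAt {H : SimpleGraph V} {M N : Set V} {π : V → ℕ} {v : V}
    (hM : invAt H M π v) (hN : invAt H N π v)
    (h : ∀ u, π u < π v → (u ∈ M ↔ u ∈ N)) : v ∈ M ↔ v ∈ N := by
  unfold invAt at hM hN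
  rw [hM, hN]
  exact forall_congr' fun u => imp_congr_right fun _ => imp_congr_right fun hlt =>
    not_congr (h u hlt)

/-- Two sets of states satisfying the invariant away from `v0` coincide, provided that agreement
before `v0` forces agreement at `v0`. -/
theorem mem_iff_mem_of_invAt {H : SimpleGraph V} {M N : Set V} {π : V → ℕ} {v0 : V}
    (hM : ∀ v ≠ v0, invAt H M π v) (hN : ∀ v ≠ v0, invAt H N π v)
    (h0 : (∀ u, π u < π v0 → (u ∈ M ↔ u ∈ N)) → (v0 ∈ M ↔ v0 ∈ N))
    (v : V) : v ∈ M ↔ v ∈ N := by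
  induction hk : π v using Nat.strong_induction_on generalizing v with
  | _ k ih =>
    subst hk
    by_cases hv0 : v = v0
    · subst hv0
      exact h0 fun u hu => ih _ hu u rfl
    exact iff_of_invAt (hM v hv0) (hN v hv0) fun u hu => ih _ hu u rfl

theorem mem_Sinfl_of_not_iff [Finite V] {H : SimpleGraph V} {M N : Set V} {π : V → ℕ} {v0 : V}
    {broken : Prop}
    (hM : ∀ v ≠ v0, invAt H M π v) (hN : ∀ v ≠ v0, invAt H N π v)
    (h0 : ¬ broken → (∀ u, π u < π v0 → (u ∈ M ↔ u ∈ N)) → (v0 ∈ M ↔ v0 ∈ N))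
    (v : V) (hv : ¬ (v ∈ M ↔ v ∈ N)) : v ∈ Sinfl H M π v0 broken := by
  by_cases hb : broken
  · rw [Sinfl, if_pos hb]
    exact mem_Sunion_of_not_iff hM hN v hv
  · exact absurd (mem_iff_mem_of_invAt hM hN (h0 hb) v) hv

theorem invAt_greedySet_of_adj_iff {G H : SimpleGraph V} {π : V → ℕ} {v : V}
    (h : ∀ u, π u < π v → (G.Adj u v ↔ H.Adj u v)) : invAt H (greedySet G π) π v := by
  rw [invAt, mem_greedySet_iff]
  exact forall_congr' fun u =>
    ⟨fun hu hadj hlt => hu ((h u hlt).2 hadj) hlt, fun hu hadj hlt => hu ((h u hlt).1 hadj) hlt⟩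

theorem invAt_greedySet_diff_singleton {G H : SimpleGraph V} {π : V → ℕ} {v0 v : V}
    (h : ∀ x y, G.Adj x y ↔ H.Adj x y ∧ x ≠ v0 ∧ y ≠ v0) (hv : v ≠ v0) :
    invAt H (greedySet G π \ {v0}) π v := by
  have hg := mem_greedySet_iff G π v
  simp only [invAt, Set.mem_sdiff, Set.mem_singleton_iff, hv, not_false_eq_true, and_true]
  rw [hg]
  refine forall_congr' fun u => ?_
  have := h u v
  tauto

theorem mem_Sset_of_edge_change [Finite V] {c : ChangeData V} {π : V → ℕ}
    (hadj : ∀ u v, v ≠ c.vs → π u < π v → (c.Gold.Adj u v ↔ c.Gnew.Adj u v))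
    (hH : c.HS = c.Gnew) (hM : c.M π = greedySet c.Gold π)
    (hb : c.broken π ↔ ¬ invAt c.Gnew (c.M π) π c.vs)
    (v : V) (hv : ¬ (v ∈ greedySet c.Gold π ↔ v ∈ greedySet c.Gnew π)) : v ∈ Sset c π := by
  have hnew : ∀ w, invAt c.Gnew (greedySet c.Gnew π) π w := fun w =>
    invAt_greedySet_of_adj_iff fun _ _ => Iff.rfl
  rw [Sset, hH]
  refine mem_Sinfl_of_not_iff (N := greedySet c.Gnew π) ?_ (fun w _ => hnew w) ?_ v (hM ▸ hv)
  · exact fun w hw => hM ▸ invAt_greedySet_of_adj_iff fun u hlt => hadj u w hw hlt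
  · exact fun hnb => iff_of_invAt (not_not.1 fun h => hnb (hb.2 h)) (hnew c.vs)

/-- Every vertex present in both graphs whose greedy-MIS membership differs between the
old and the new graph belongs to the influenced set `S`. (For a node change, the vertex
`v*` itself is excluded.) -/
theorem stmt12 {V : Type*} [Fintype V] (c : ChangeData V) (hc : IsTopoChange c)
    (π : V → ℕ) (hπ : Function.Injective π) (hord : π c.vss ≤ π c.vs)
    (v : V) (hv : v ≠ c.vs ∨ IsEdgeIns c ∨ IsEdgeDel c)
    (hdiff : (v ∈ greedySet c.Gold π ∧ v ∉ greedySet c.Gnew π) ∨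
             (v ∉ greedySet c.Gold π ∧ v ∈ greedySet c.Gnew π)) :
    v ∈ Sset c π := by
  have hne : ¬ (v ∈ greedySet c.Gold π ↔ v ∈ greedySet c.Gnew π) := by tauto
  have hvs : c.vss = c.vs → v ≠ c.vs := fun h =>
    hv.resolve_right fun h' => h'.elim (fun h' => h'.1 h.symm) fun h' => h'.1 h.symm
  have hedge : ∀ x y, π x < π y → ¬ (x = c.vs ∧ y = c.vss) := by
    rintro x y hlt ⟨rfl, rfl⟩
    omega
  rcases hc with h | h | h | h
  · obtain ⟨-, -, hadj, hH, -, hM, hb⟩ := h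
    refine mem_Sset_of_edge_change (fun x y hy hlt => ?_) hH (hM π) (hb π) v hne
    rw [hadj]
    have := hedge x y hlt
    tauto
  · obtain ⟨-, -, hadj, hH, -, hM, hb⟩ := h
    refine mem_Sset_of_edge_change (fun x y hy hlt => ?_) hH (hM π) (hb π) v hne
    rw [hadj]
    have := hedge x y hlt
    tauto
  · have hvs := hvs h.1
    obtain ⟨-, hadj, hH, -, hM, hb⟩ := h
    rw [Sset, hH]
    refine mem_Sinfl_of_not_iff (N := greedySet c.Gnew π \ {c.vs}) ?_
      (fun w hw => invAt_greedySet_diff_singleton hadj hw) ?_ v ?_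
    · exact fun w _ => hM π ▸ invAt_greedySet_of_adj_iff fun _ _ => Iff.rfl
    · exact fun hnb _ => iff_of_false (fun h => hnb ((hb π).2 h)) fun h => h.2 rfl
    · simpa [hM π, hvs] using hne
  · have hvs := hvs h.1
    obtain ⟨-, hadj, hH, -, hM, hb⟩ := h
    have hnew : ∀ w, invAt c.Gnew (greedySet c.Gnew π) π w := fun w =>
      invAt_greedySet_of_adj_iff fun _ _ => Iff.rfl
    rw [Sset, hH]
    refine mem_Sinfl_of_not_iff (N := greedySet c.Gnew π) ?_ (fun w _ => hnew w) ?_ v ?_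
    · exact fun w hw => hM π ▸ invAt_greedySet_diff_singleton hadj hw
    · intro hnb
      refine iff_of_invAt (iff_of_false ?_ fun h => ?_) (hnew c.vs)
      · rw [hM π]
        exact fun h => h.2 rfl
      · rw [hb π, not_not] at hnb
        obtain ⟨u, hu, hlt, huM⟩ := hnb
        exact h u hu hlt huM
    · simpa [hM π, hvs] using hne

end
end

section
/- Let G_old=(V,E_old) and G_new=(V,E_new) be finite simple graphs on the same vertex set that differ in exactly one edge. Then, for a uniformly random linear order π on V, the expected size of the symmetric difference of the two greedy maximal independent sets satisfies E_π[|M(G_old,π) Δ M(G_new,π)|] ≤ 1 (single adjustment in expectation). -/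
open scoped Classical

noncomputable section

variable {V : Type*}

theorem Finset.sum_ite_le_card_of_shift {X : Type*} (s : Finset X) (r m : X → ℕ) (T : X → X)
    (hT : ∀ x ∈ s, r x + 1 < m x → T x ∈ s ∧ r (T x) = r x + 1 ∧ m (T x) = m x)
    (hinj : ∀ x ∈ s, r x + 1 < m x → ∀ y ∈ s, r y + 1 < m y → T x = T y → x = y) :
    ∑ x ∈ s, (if r x = 0 then m x else 0) ≤ s.card := by
  have key : ∀ k j, j ≤ k → (s.filter fun x => r x = 0 ∧ k < m x).card ≤
      (s.filter fun x => r x = j ∧ k < m x).card := by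
    intro k j
    induction j with
    | zero => intro _; exact le_rfl
    | succ j ih =>
      intro hj
      refine (ih (by omega)).trans (Finset.card_le_card_of_injOn T ?_ ?_)
      · intro x hx
        simp only [Finset.coe_filter, Set.mem_ofPred_eq] at hx ⊢
        obtain ⟨h1, h2, h3⟩ := hT x hx.1 (by omega)
        exact ⟨h1, by omega, by omega⟩
      · intro x hx y hy hxy
        simp only [Finset.coe_filter, Set.mem_ofPred_eq] at hx hy
        exact hinj x hx.1 (by omega) y hy.1 (by omega) hxy
  let N := s.sup m
  calc ∑ x ∈ s, (if r x = 0 then m x else 0)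
      = ∑ x ∈ s, ∑ k ∈ Finset.range N, (if r x = 0 ∧ k < m x then 1 else 0) := by
        refine Finset.sum_congr rfl fun x hx => ?_
        have hm : m x ≤ N := Finset.le_sup hx
        rw [← Finset.card_filter]
        by_cases h : r x = 0
        · have : (Finset.range N).filter (fun k => r x = 0 ∧ k < m x) = Finset.range (m x) := by
            ext k
            simp only [Finset.mem_filter, Finset.mem_range]
            omega
          rw [this, Finset.card_range, if_pos h]
        · simp [h]
    _ = ∑ k ∈ Finset.range N, (s.filter fun x => r x = 0 ∧ k < m x).card := by
        rw [Finset.sum_comm]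
        exact Finset.sum_congr rfl fun k _ => (Finset.card_filter _ _).symm
    _ ≤ ∑ k ∈ Finset.range N, (s.filter fun x => r x = k ∧ k < m x).card :=
        Finset.sum_le_sum fun k _ => key k k le_rfl
    _ = ∑ x ∈ s, ∑ k ∈ Finset.range N, (if r x = k ∧ k < m x then 1 else 0) := by
        rw [Finset.sum_comm]
        exact Finset.sum_congr rfl fun k _ => Finset.card_filter _ _
    _ ≤ ∑ x ∈ s, 1 := by
        refine Finset.sum_le_sum fun x _ => ?_
        rw [← Finset.card_filter, Finset.card_le_one]
        intro i hi j hj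
        simp only [Finset.mem_filter] at hi hj
        omega
    _ = s.card := by simp

/-- Membership in the greedy MIS when `b` comes first and is in the set iff `p`. -/
def forced (H : SimpleGraph V) (π : V → ℕ) (b : V) (p : Prop) (v : V) : Prop :=
  (v = b → p) ∧
    (v ≠ b → ∀ u, H.Adj u v → ∀ _hlt : pushFirst π b u < pushFirst π b v, ¬ forced H π b p u)
termination_by pushFirst π b v

theorem pushFirst_lt_iff {π : V → ℕ} {b u v : V} (hv : v ≠ b) :
    pushFirst π b u < pushFirst π b v ↔ u = b ∨ π u < π v := by
  unfold pushFirst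
  by_cases hu : u = b <;> simp [hu, hv]

theorem forced_self (H : SimpleGraph V) (π : V → ℕ) (b : V) (p : Prop) :
    forced H π b p b ↔ p := by
  rw [forced]; simp

theorem forced_of_ne (H : SimpleGraph V) (π : V → ℕ) {b v : V} (p : Prop) (hv : v ≠ b) :
    forced H π b p v ↔ ∀ u, H.Adj u v → (u = b ∨ π u < π v) → ¬ forced H π b p u := by
  rw [forced]
  simp only [hv, false_imp_iff, true_and, ne_eq, not_false_eq_true, true_imp_iff,
    pushFirst_lt_iff hv]

theorem eq_forced (H : SimpleGraph V) (π : V → ℕ) (b : V) (p : Prop) (M : V → Prop)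
    (hb : M b ↔ p)
    (hM : ∀ v, v ≠ b → (M v ↔ ∀ u, H.Adj u v → (u = b ∨ π u < π v) → ¬ M u)) (v : V) :
    M v ↔ forced H π b p v := by
  induction hn : pushFirst π b v using Nat.strong_induction_on generalizing v with
  | _ n ih =>
    by_cases hv : v = b
    · subst hv; rw [forced_self, hb]
    · rw [hM v hv, forced_of_ne H π p hv]
      refine forall_congr' fun u => forall_congr' fun _ => forall_congr' fun hu => ?_
      rw [ih _ (hn ▸ (pushFirst_lt_iff hv).2 hu) u rfl]

theorem greedy_iff (G : SimpleGraph V) (π : V → ℕ) (v : V) :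
    greedy G π v ↔ ∀ u, G.Adj u v → π u < π v → ¬ greedy G π u := by
  rw [greedy]

theorem greedy_congr (G : SimpleGraph V) (π : V → ℕ) (M : V → Prop) (v : V)
    (hM : ∀ w, π w ≤ π v → (M w ↔ ∀ u, G.Adj u w → π u < π w → ¬ M u)) :
    M v ↔ greedy G π v := by
  induction hn : π v using Nat.strong_induction_on generalizing v with
  | _ n ih =>
    rw [hM v le_rfl, greedy_iff]
    refine forall_congr' fun u => forall_congr' fun _ => forall_congr' fun hu => ?_
    rw [ih _ (hn ▸ hu) u (fun w hw => hM w (hw.trans hu.le)) rfl]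

/-- The vertices whose state depends on the state of `b` when `b` comes first. -/
def affected [Fintype V] (H : SimpleGraph V) (π : V → ℕ) (b : V) : Finset V :=
  Finset.univ.filter fun v => ¬ (forced H π b True v ↔ forced H π b False v)

theorem mem_affected [Fintype V] {H : SimpleGraph V} {π : V → ℕ} {b v : V} :
    v ∈ affected H π b ↔ ¬ (forced H π b True v ↔ forced H π b False v) := by
  simp [affected]

theorem self_mem_affected [Fintype V] (H : SimpleGraph V) (π : V → ℕ) (b : V) :
    b ∈ affected H π b := by
  simp [mem_affected, forced_self]

/-- The number of affected vertices preceding `b`. -/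
def affectedRank [Fintype V] (H : SimpleGraph V) (π : V → ℕ) (b : V) : ℕ :=
  ((affected H π b).filter fun v => π v < π b).card

theorem ncard_symmDiff_greedySet_le [Fintype V] {H G : SimpleGraph V} {π : V → ℕ} {a b : V}
    (hπ : π a < π b) (hπi : Function.Injective π)
    (hG : ∀ x y, G.Adj x y ↔ H.Adj x y ∨ (x = a ∧ y = b) ∨ (x = b ∧ y = a)) :
    (symmDiff (greedySet H π) (greedySet G π)).ncard ≤
      if affectedRank H π b = 0 then (affected H π b).card else 0 := by
  have hadj : ∀ u v, π u < π v → v ≠ b → (G.Adj u v ↔ H.Adj u v) := by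
    intro u v huv hv
    rw [hG]
    refine ⟨?_, Or.inl⟩
    rintro (h | ⟨rfl, rfl⟩ | ⟨rfl, rfl⟩)
    · exact h
    · exact absurd rfl hv
    · omega
  have hab : a ≠ b := by rintro rfl; omega
  by_cases hboth : greedy H π a ∧ greedy H π b
  · obtain ⟨ha, hb⟩ := hboth
    have hearly : ∀ v, π v < π b → (greedy H π v ↔ greedy G π v) := by
      intro v hv
      refine greedy_congr G π _ v fun w hw => ?_
      have hwb : w ≠ b := by rintro rfl; omega
      rw [greedy_iff]
      refine forall_congr' fun u => ⟨fun h h1 h2 => h ((hadj u w h2 hwb).1 h1) h2,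
        fun h h1 h2 => h ((hadj u w h2 hwb).2 h1) h2⟩
    have hGb : ¬ greedy G π b := by
      rw [greedy_iff]
      intro h
      exact h a ((hG a b).2 (by simp)) hπ ((hearly a hπ).1 ha)
    have h1 : ∀ v, greedy H π v ↔ forced H π b True v := by
      refine eq_forced H π b True _ (by simpa using hb) fun v hv => ?_
      constructor
      · rintro hgv u huv (rfl | hlt)
        · exfalso
          rcases lt_trichotomy (π u) (π v) with h | h | h
          · exact (greedy_iff H π v).1 hgv u huv h hb
          · exact hv (hπi h).symm
          · exact (greedy_iff H π u).1 hb v huv.symm h hgv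
        · exact (greedy_iff H π v).1 hgv u huv hlt
      · intro h
        exact (greedy_iff H π v).2 fun u hu hlt => h u hu (Or.inr hlt)
    have h2 : ∀ v, greedy G π v ↔ forced H π b False v := by
      refine eq_forced H π b False _ (by simpa using hGb) fun v hv => ?_
      rw [greedy_iff]
      constructor
      · rintro h u huv (rfl | hlt)
        · exact hGb
        · exact h u ((hadj u v hlt hv).2 huv) hlt
      · intro h u huv hlt
        exact h u ((hadj u v hlt hv).1 huv) (Or.inr hlt)
    have hr : affectedRank H π b = 0 := by
      rw [affectedRank, Finset.card_eq_zero, Finset.filter_eq_empty_iff]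
      intro v hv hlt
      exact mem_affected.1 hv (by rw [← h1, ← h2, hearly v hlt])
    rw [if_pos hr, ← Set.ncard_coe_finset]
    refine Set.ncard_le_ncard (fun v hv => ?_) (Finset.finite_toSet _)
    rw [Finset.mem_coe, mem_affected, ← h1, ← h2]
    rw [Set.mem_symmDiff] at hv
    change (greedy H π v ∧ ¬ greedy G π v) ∨ (greedy G π v ∧ ¬ greedy H π v) at hv
    tauto
  · have heq : greedySet H π = greedySet G π := by
      ext v
      refine greedy_congr G π (greedy H π) v fun w _ => ?_
      rw [greedy_iff]
      by_cases hw : w = b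
      · subst hw
        constructor
        · intro h u hu hlt
          rcases (hG u w).1 hu with h' | ⟨rfl, -⟩ | ⟨rfl, -⟩
          · exact h u h' hlt
          · exact fun hgu => hboth ⟨hgu, (greedy_iff H π w).2 h⟩
          · omega
        · exact fun h u hu hlt => h u ((hG u w).2 (Or.inl hu)) hlt
      · exact forall_congr' fun u => ⟨fun h h1 h2 => h ((hadj u w h2 hw).1 h1) h2,
          fun h h1 h2 => h ((hadj u w h2 hw).2 h1) h2⟩
    simp [heq]

/-- `c` is the affected vertex immediately following `b` among the affected vertices. -/
structure IsNextAffected [Fintype V] (H : SimpleGraph V) (π : V → ℕ) (b c : V) : Prop where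
  mem : c ∈ affected H π b
  lt : π b < π c
  le : ∀ x ∈ affected H π b, π b < π x → π c ≤ π x

theorem forced_swap [Fintype V] [DecidableEq V] {H : SimpleGraph V} {π : V → ℕ} {b c : V}
    (hπ : Function.Injective π) (hc : IsNextAffected H π b c) (p : Prop) (v : V) :
    forced H (π ∘ Equiv.swap b c) b p v ↔ forced H π b p v := by
  set ρ := π ∘ Equiv.swap b c with hρ
  have hcb : c ≠ b := by rintro rfl; exact lt_irrefl _ hc.lt
  have hρc : ρ c = π b := by simp [hρ]
  have hρo : ∀ x, x ≠ b → x ≠ c → ρ x = π x := fun x h1 h2 => by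
    simp [hρ, Equiv.swap_apply_of_ne_of_ne h1 h2]
  have hlt := hc.lt
  have horder : ∀ u v, v ≠ b →
      ((u ∈ affected H π b → v ∈ affected H π b → (u = b ∨ π u < π v) → (u = b ∨ ρ u < ρ v)) ∧
      (v ∈ affected H π b → (u = b ∨ ρ u < ρ v) → (u = b ∨ π u < π v)) ∧
      (v ∉ affected H π b → (u = b ∨ π u < π v) → (u = b ∨ ρ u < ρ v))) := by
    intro u v hv
    by_cases hu : u = b
    · simp [hu]
    simp only [hu, false_or]
    by_cases huc : u = c
    · subst huc
      by_cases hvc : v = u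
      · subst hvc; simp
      rw [hρc, hρo v hv hvc]
      refine ⟨fun _ _ h => by omega, fun hva h => ?_, fun _ h => by omega⟩
      exact lt_of_le_of_ne (hc.le v hva h) fun h => hvc (hπ h).symm
    · rw [hρo u hu huc]
      by_cases hvc : v = c
      · subst hvc
        rw [hρc]
        refine ⟨fun hua _ h => ?_, fun _ h => by omega, fun h => absurd hc.mem h⟩
        rcases lt_trichotomy (π u) (π b) with h' | h' | h'
        · exact h'
        · exact absurd (hπ h') hu
        · exact absurd (hc.le u hua h') (by omega)
      · rw [hρo v hv hvc]
        exact ⟨fun _ _ h => h, fun _ h => h, fun _ h => h⟩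
  have haff : ∀ x, x ∈ affected H π b ↔ ¬ (forced H π b p x ↔ forced H π b (¬ p) x) := by
    intro x
    rw [mem_affected]
    by_cases hp : p <;> simp only [hp, not_true_eq_false, not_false_eq_true]
    rw [iff_comm (a := forced H π b True x)]
  symm
  refine eq_forced H ρ b p (forced H π b p) (forced_self ..) (fun v hv => ?_) v
  by_cases hva : v ∈ affected H π b
  · constructor
    · intro h u hu hlt
      exact (forced_of_ne H π p hv).1 h u hu ((horder u v hv).2.1 hva hlt)
    · intro h
      by_contra hn
      have hv' : forced H π b (¬ p) v := by
        have := (haff v).1 hva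
        tauto
      have hn' := hn
      rw [forced_of_ne H π p hv] at hn'
      push Not at hn'
      obtain ⟨u, hu, hlt, hfu⟩ := hn'
      have hu' := (forced_of_ne H π (¬ p) hv).1 hv' u hu hlt
      have hua : u ∈ affected H π b := (haff u).2 (by tauto)
      exact h u hu ((horder u v hv).1 hua hva hlt) hfu
  · constructor
    · intro h u hu hlt hfu
      by_cases hR : u = b ∨ π u < π v
      · exact (forced_of_ne H π p hv).1 h u hu hR hfu
      · push Not at hR
        have hvu : π v < π u := lt_of_le_of_ne hR.2 fun h => hu.ne (hπ h).symm
        exact (forced_of_ne H π p hR.1).1 hfu v hu.symm (Or.inr hvu) h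
    · intro h
      rw [forced_of_ne H π p hv]
      exact fun u hu hlt => h u hu ((horder u v hv).2.2 hva hlt)

theorem affected_swap [Fintype V] [DecidableEq V] {H : SimpleGraph V} {π : V → ℕ} {b c : V}
    (hπ : Function.Injective π) (hc : IsNextAffected H π b c) :
    affected H (π ∘ Equiv.swap b c) b = affected H π b := by
  ext v
  simp only [mem_affected, forced_swap hπ hc]

theorem affectedRank_swap [Fintype V] [DecidableEq V] {H : SimpleGraph V} {π : V → ℕ} {b c : V}
    (hπ : Function.Injective π) (hc : IsNextAffected H π b c) :
    affectedRank H (π ∘ Equiv.swap b c) b = affectedRank H π b + 1 := by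
  have hlt := hc.lt
  have hcb : c ≠ b := by rintro rfl; exact lt_irrefl _ hlt
  rw [affectedRank, affectedRank, affected_swap hπ hc,
    ← Finset.card_insert_of_notMem (a := c) (by simp [hlt.le])]
  congr 1
  ext v
  simp only [Finset.mem_filter, Finset.mem_insert, Function.comp, Equiv.swap_apply_left]
  by_cases hvc : v = c
  · subst hvc; simp [hc.mem, hlt]
  by_cases hvb : v = b
  · subst hvb; simp [hvc]
  rw [Equiv.swap_apply_of_ne_of_ne hvb hvc]
  simp only [hvc, false_or]
  refine and_congr_right fun hva => ⟨fun h => ?_, fun h => by omega⟩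
  by_contra hn
  have hne : π b ≠ π v := fun h => hvb (hπ h).symm
  have := hc.le v hva (by omega)
  omega

theorem exists_isNextAffected [Fintype V] {H : SimpleGraph V} {π : V → ℕ} {b : V}
    (hπ : Function.Injective π) (h : affectedRank H π b + 1 < (affected H π b).card) :
    ∃ c, IsNextAffected H π b c := by
  have hne : ((affected H π b).filter fun v => π b < π v).Nonempty := by
    by_contra hemp
    rw [Finset.not_nonempty_iff_eq_empty, Finset.filter_eq_empty_iff] at hemp
    have hsub : affected H π b ⊆ insert b ((affected H π b).filter fun v => π v < π b) := by
      intro v hv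
      rw [Finset.mem_insert, Finset.mem_filter]
      by_cases hvb : v = b
      · exact Or.inl hvb
      · exact Or.inr ⟨hv, lt_of_le_of_ne (not_lt.1 (hemp hv)) fun h => hvb (hπ h)⟩
    have h1 := Finset.card_le_card hsub
    have h2 := Finset.card_insert_le b ((affected H π b).filter fun v => π v < π b)
    rw [affectedRank] at h
    omega
  obtain ⟨c, hc, hmin⟩ := Finset.exists_min_image _ π hne
  simp only [Finset.mem_filter] at hc hmin
  exact ⟨c, hc.1, hc.2, fun x hx hlt => hmin x ⟨hx, hlt⟩⟩

theorem IsNextAffected.le_of_swap_eq [Fintype V] [DecidableEq V] {H : SimpleGraph V} {π σ : V → ℕ}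
    {b c d : V} (hπ : Function.Injective π) (hσ : Function.Injective σ)
    (hc : IsNextAffected H π b c) (hd : IsNextAffected H σ b d)
    (h : π ∘ Equiv.swap b c = σ ∘ Equiv.swap b d) : σ b ≤ π b := by
  have hP : affected H π b = affected H σ b := by
    rw [← affected_swap hπ hc, ← affected_swap hσ hd, h]
  have hdb : d ≠ b := by rintro rfl; exact lt_irrefl _ hd.lt
  by_cases hdc : d = c
  · subst hdc
    have := congrFun h d
    simp at this
    omega
  have e1 : π c = σ d := by simpa using congrFun h b
  have e2 : π d = σ b := by
    simpa [Equiv.swap_apply_of_ne_of_ne hdb hdc] using congrFun h d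
  by_contra hlt
  have := hc.le d (hP ▸ hd.mem) (by omega)
  have := hd.lt
  omega

theorem IsNextAffected.eq_of_swap_eq [Fintype V] [DecidableEq V] {H : SimpleGraph V} {π σ : V → ℕ}
    {b c d : V} (hπ : Function.Injective π) (hσ : Function.Injective σ)
    (hc : IsNextAffected H π b c) (hd : IsNextAffected H σ b d)
    (h : π ∘ Equiv.swap b c = σ ∘ Equiv.swap b d) : π = σ := by
  have hb : π b = σ b :=
    le_antisymm (hd.le_of_swap_eq hσ hπ hc h.symm) (hc.le_of_swap_eq hπ hσ hd h)
  have hcd : c = d := by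
    apply (hπ.comp (Equiv.swap b c).injective)
    rw [congrFun h d]
    simp [hb]
  subst hcd
  funext v
  simpa using congrFun h (Equiv.swap b c v)

theorem toOrd_injective [Fintype V] (π : V ≃ Fin (Fintype.card V)) :
    Function.Injective (toOrd π) :=
  Fin.val_injective.comp π.injective

theorem toOrd_inj [Fintype V] {π σ : V ≃ Fin (Fintype.card V)} (h : toOrd π = toOrd σ) :
    π = σ :=
  Equiv.ext fun v => Fin.ext (congrFun h v)

theorem sum_affected_le_card [Fintype V] [DecidableEq V] (H : SimpleGraph V) (a b : V) :
    ∑ π ∈ (Finset.univ : Finset (V ≃ Fin (Fintype.card V))).filter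
        (fun π => toOrd π a < toOrd π b),
      (if affectedRank H (toOrd π) b = 0 then (affected H (toOrd π) b).card else 0) ≤
    ((Finset.univ : Finset (V ≃ Fin (Fintype.card V))).filter
        (fun π => toOrd π a < toOrd π b)).card := by
  choose c hc using fun (π : V ≃ Fin (Fintype.card V))
    (h : affectedRank H (toOrd π) b + 1 < (affected H (toOrd π) b).card) =>
    exists_isNextAffected (toOrd_injective π) h
  let T : (V ≃ Fin (Fintype.card V)) → (V ≃ Fin (Fintype.card V)) := fun π =>
    if h : affectedRank H (toOrd π) b + 1 < (affected H (toOrd π) b).card then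
      (Equiv.swap b (c π h)).trans π else π
  have hT : ∀ π h, toOrd (T π) = toOrd π ∘ Equiv.swap b (c π h) := by
    intro π h
    simp only [T, dif_pos h]
    rfl
  refine Finset.sum_ite_le_card_of_shift _ (fun π => affectedRank H (toOrd π) b)
    (fun π => (affected H (toOrd π) b).card) T ?_ ?_
  · intro π hπ h
    have hn := hc π h
    have hi := toOrd_injective π
    refine ⟨?_, ?_, ?_⟩
    · simp only [Finset.mem_filter, Finset.mem_univ, true_and] at hπ ⊢
      have hlt := hn.lt
      rw [hT π h, Function.comp, Function.comp, Equiv.swap_apply_left,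
        Equiv.swap_apply_of_ne_of_ne]
      · omega
      · rintro rfl; omega
      · intro he; rw [← he] at hlt; omega
    · simp only [hT π h]
      exact affectedRank_swap hi hn
    · simp only [hT π h]
      rw [affected_swap hi hn]
  · intro π _ h σ _ h' he
    refine toOrd_inj ((hc π h).eq_of_swap_eq (toOrd_injective π) (toOrd_injective σ) (hc σ h') ?_)
    rw [← hT, ← hT, he]

theorem sum_ncard_symmDiff_le [Fintype V] [DecidableEq V] {H G : SimpleGraph V} {a b : V}
    (hab : a ≠ b)
    (hG : ∀ x y, G.Adj x y ↔ H.Adj x y ∨ (x = a ∧ y = b) ∨ (x = b ∧ y = a)) :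
    ∑ π : V ≃ Fin (Fintype.card V),
        (symmDiff (greedySet H (toOrd π)) (greedySet G (toOrd π))).ncard ≤
      Fintype.card (V ≃ Fin (Fintype.card V)) := by
  have hnot : ∀ π : V ≃ Fin (Fintype.card V),
      ¬ toOrd π a < toOrd π b ↔ toOrd π b < toOrd π a := by
    intro π
    have : toOrd π a ≠ toOrd π b := fun h => hab (toOrd_injective π h)
    omega
  rw [← Finset.card_univ (α := V ≃ Fin (Fintype.card V)),
    ← Finset.sum_filter_add_sum_filter_not Finset.univ
      (fun π => toOrd π a < toOrd π b),
    ← Finset.card_filter_add_card_filter_not (s := Finset.univ)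
      (fun π : V ≃ Fin (Fintype.card V) => toOrd π a < toOrd π b)]
  simp only [hnot]
  refine add_le_add (le_trans (Finset.sum_le_sum fun π hπ => ?_) (sum_affected_le_card H a b))
    (le_trans (Finset.sum_le_sum fun π hπ => ?_) (sum_affected_le_card H b a))
  · exact ncard_symmDiff_greedySet_le (Finset.mem_filter.1 hπ).2 (toOrd_injective π) hG
  · refine ncard_symmDiff_greedySet_le (Finset.mem_filter.1 hπ).2 (toOrd_injective π)
      fun x y => ?_
    rw [hG]
    tauto

/-- For a single edge change, the expected size of the symmetric difference of the two
greedy maximal independent sets is at most 1. -/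
theorem stmt13 {V : Type*} [Fintype V] [DecidableEq V]
    (Gold Gnew : SimpleGraph V) (a b : V) (hab : a ≠ b)
    (h : (¬ Gold.Adj a b ∧
            ∀ x y, Gnew.Adj x y ↔ Gold.Adj x y ∨ (x = a ∧ y = b) ∨ (x = b ∧ y = a)) ∨
         (Gold.Adj a b ∧
            ∀ x y, Gnew.Adj x y ↔ Gold.Adj x y ∧ ¬ ((x = a ∧ y = b) ∨ (x = b ∧ y = a)))) :
    (∑ π : V ≃ Fin (Fintype.card V),
        ((symmDiff (greedySet Gold (toOrd π)) (greedySet Gnew (toOrd π))).ncard : ℝ))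
      / (Fintype.card (V ≃ Fin (Fintype.card V)) : ℝ) ≤ 1 := by
  refine div_le_one_of_le₀ ?_ (Nat.cast_nonneg _)
  rw [← Nat.cast_sum, Nat.cast_le]
  rcases h with ⟨-, hG⟩ | ⟨hadj, hG⟩
  · exact sum_ncard_symmDiff_le hab hG
  · simp only [symmDiff_comm (greedySet Gold _)]
    refine sum_ncard_symmDiff_le hab fun x y => ?_
    rw [hG]
    by_cases hxy : (x = a ∧ y = b) ∨ (x = b ∧ y = a)
    · have : Gold.Adj x y := by
        rcases hxy with ⟨rfl, rfl⟩ | ⟨rfl, rfl⟩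
        exacts [hadj, hadj.symm]
      tauto
    · tauto

end
end
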